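/- Let A_S be an Artin group of large type and let A_X be the standard parabolic subgroup associated to a subset X ⊆ S. Then A_X is NOT conjugacy stable in A_S if and only if there exist a, b ∈ X that are connected by an odd-labelled path in Γ_S but are not connected by an odd-labelled path in Γ_X. -/

import Mathlib

/-- The alternating word `sts⋯` of length `k` in the free group on `S`. -/
def braidWord {S : Type*} (k : ℕ) (s t : S) : FreeGroup S :=
  ((List.range k).map fun i => FreeGroup.of (if i % 2 = 0 then s else t)).prod

/-- The braid relations of the Artin group with Coxeter-type matrix `M`
(`M s t = ⊤` means no relation). -/
def artinRels {S : Type*} (M : S → S → ℕ∞) : Set (FreeGroup S) :=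
  { r | ∃ s t : S, s ≠ t ∧ ∃ k : ℕ, M s t = (k : ℕ∞) ∧
      r = braidWord k s t * (braidWord k t s)⁻¹ }

/-- The Artin group associated to the matrix `M`. -/
abbrev ArtinGroup {S : Type*} (M : S → S → ℕ∞) : Type _ := PresentedGroup (artinRels M)

/-- The standard parabolic subgroup `A_X` generated by the images of elements of `X ⊆ S`. -/
def StandardParabolic {S : Type*} (M : S → S → ℕ∞) (X : Set S) : Subgroup (ArtinGroup M) :=
  Subgroup.closure ((fun s => (PresentedGroup.of s : ArtinGroup M)) '' X)

/-- The conjugate `g H g⁻¹` of a subgroup. -/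
def conjSubgroup {G : Type*} [Group G] (g : G) (H : Subgroup G) : Subgroup G :=
  H.map (MulAut.conj g).toMonoidHom

/-- A parabolic subgroup: a conjugate of a standard parabolic subgroup. -/
def IsParabolic {S : Type*} (M : S → S → ℕ∞) (P : Subgroup (ArtinGroup M)) : Prop :=
  ∃ (g : ArtinGroup M) (X : Set S), P = conjSubgroup g (StandardParabolic M X)

/-- `a` and `b` are connected by an odd-labelled path in the Coxeter graph induced on
`X ⊆ S`: each step joins two elements of `X` whose label is odd (in particular finite). -/
def OddConnected {S : Type*} (M : S → S → ℕ∞) (X : Set S) (a b : S) : Prop :=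
  Relation.ReflTransGen
    (fun s t => s ∈ X ∧ t ∈ X ∧ ∃ k : ℕ, M s t = (k : ℕ∞) ∧ Odd k) a b

/-- A subgroup `H` of a group `G` is conjugacy stable if any two elements of `H` that
are conjugate in `G` are already conjugate by an element of `H`. -/
def ConjugacyStable {G : Type*} [Group G] (H : Subgroup G) : Prop :=
  ∀ a b : G, a ∈ H → b ∈ H → (∃ α : G, a = α⁻¹ * b * α) → ∃ β ∈ H, a = β⁻¹ * b * β

/-! ### Alternating products -/

/-- The alternating product `aba⋯` with `k` factors. -/
def altProd {G : Type*} [Monoid G] (a b : G) (k : ℕ) : G :=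
  ((List.range k).map fun i => if i % 2 = 0 then a else b).prod

section AltProd

variable {G H : Type*}

@[simp]
lemma altProd_zero [Monoid G] (a b : G) : altProd a b 0 = 1 := by simp [altProd]

lemma altProd_succ [Monoid G] (a b : G) (k : ℕ) :
    altProd a b (k + 1) = altProd a b k * (if k % 2 = 0 then a else b) := by
  simp [altProd, List.range_succ]

lemma altProd_succ' [Monoid G] (a b : G) (k : ℕ) :
    altProd a b (k + 1) = a * altProd b a k := by
  induction k with
  | zero => simp [altProd_succ]
  | succ k ih =>
    rw [altProd_succ, ih, altProd_succ b a k, mul_assoc]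
    rcases Nat.mod_two_eq_zero_or_one k with h | h <;> simp [h, Nat.add_mod]

lemma map_altProd [Monoid G] [Monoid H] (f : G →* H) (a b : G) (k : ℕ) :
    f (altProd a b k) = altProd (f a) (f b) k := by
  induction k with
  | zero => simp
  | succ k ih => rw [altProd_succ, altProd_succ, map_mul, ih, apply_ite f]

lemma lift_braidWord {S : Type*} [Group G] (f : S → G) (k : ℕ) (s t : S) :
    FreeGroup.lift f (braidWord k s t) = altProd (f s) (f t) k := by
  have h : braidWord k s t = altProd (FreeGroup.of s) (FreeGroup.of t) k := by
    simp only [braidWord, altProd, apply_ite]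
  rw [h, map_altProd]
  simp

lemma altProd_mem [Group G] (K : Subgroup G) {a b : G} (ha : a ∈ K) (hb : b ∈ K) (k : ℕ) :
    altProd a b k ∈ K := by
  refine Subgroup.list_prod_mem _ fun x hx => ?_
  obtain ⟨i, -, rfl⟩ := List.mem_map.1 hx
  split_ifs <;> assumption

lemma altProd_comm_of_even_or_eq [CommGroup G] {a b : G} {k : ℕ} (h : Odd k → a = b) :
    altProd a b k = altProd b a k := by
  rcases Nat.even_or_odd k with ⟨j, rfl⟩ | hk
  · induction j with
    | zero => simp
    | succ j ih =>
      have ih' := ih fun ho => absurd ho (by simp)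
      rw [show j + 1 + (j + 1) = (j + j) + 1 + 1 by ring, altProd_succ', altProd_succ',
        altProd_succ' b a, altProd_succ' a b, ih']
      rw [← mul_assoc, ← mul_assoc, mul_comm a b]
  · rw [h hk]

lemma altProd_eq_pow_mul [Group G] {a b : G} (ha : a * a = 1) (hb : b * b = 1) (k : ℕ) :
    altProd a b k = (a * b) ^ k * altProd b a k := by
  induction k with
  | zero => simp
  | succ k ih =>
    have h1 : (a * b) ^ k * (b * a) ^ k = 1 := by
      have : b * a = (a * b)⁻¹ := by
        rw [mul_inv_rev, inv_eq_of_mul_eq_one_left ha, inv_eq_of_mul_eq_one_left hb]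
      rw [this, inv_pow, mul_inv_cancel]
    have h2 : (a * b) ^ (k + 1) * b = a * (b * a) ^ k := by
      rw [pow_succ, mul_assoc, mul_assoc a b b, hb, mul_one, mul_pow_mul]
    rw [altProd_succ', altProd_succ' b a, ← mul_assoc, h2, ih, mul_assoc,
      ← mul_assoc _ _ (altProd b a k)]
    have h3 : (b * a) ^ k * (a * b) ^ k = 1 := by
      rw [← inv_eq_iff_mul_eq_one.2 h1, inv_mul_cancel]
    rw [h3, one_mul]

lemma altProd_comm_iff [Group G] {a b : G} (ha : a * a = 1) (hb : b * b = 1) (k : ℕ) :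
    altProd a b k = altProd b a k ↔ (a * b) ^ k = 1 := by
  rw [altProd_eq_pow_mul ha hb, mul_eq_right]

/-- The reflections swept out by an alternating product of two involutions. -/
lemma altProd_succ_mul_inv [Group G] {a b : G} (ha : a * a = 1) (hb : b * b = 1) (k : ℕ) :
    altProd a b (k + 1) * (altProd a b k)⁻¹ = a * (b * a) ^ k := by
  rw [altProd_succ', altProd_eq_pow_mul hb ha, mul_assoc, mul_assoc, mul_inv_cancel, mul_one]

lemma altProd_succ_mul_inv_reflect [Group G] {a b : G} (ha : a * a = 1) (hb : b * b = 1)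
    {m i : ℕ} (hm : (a * b) ^ m = 1) (hi : i < m) :
    altProd b a (m - 1 - i + 1) * (altProd b a (m - 1 - i))⁻¹ =
      altProd a b (i + 1) * (altProd a b i)⁻¹ := by
  have hba : b * a = (a * b)⁻¹ := by
    rw [mul_inv_rev, inv_eq_of_mul_eq_one_left ha, inv_eq_of_mul_eq_one_left hb]
  rw [altProd_succ_mul_inv hb ha, altProd_succ_mul_inv ha hb]
  have h1 : (a * b) ^ (m - 1 - i) = (a * b)⁻¹ * (b * a) ^ i := by
    rw [hba, inv_pow, ← mul_inv_rev, eq_inv_iff_mul_eq_one, ← pow_succ, ← pow_add,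
      show m - 1 - i + (i + 1) = m by omega, hm]
  rw [h1, ← hba, ← mul_assoc, ← mul_assoc, hb, one_mul]

end AltProd

/-! ### Crossed homomorphisms as homomorphisms to a wreath product -/

section Wreath

variable {W G Ω : Type*} [Group W] [Group G]

/-- The action of `W` on functions `Ω → G` induced by an action of `W` on `Ω`. -/
def funAct (G : Type*) [Group G] (ψ : W →* Equiv.Perm Ω) : W →* MulAut (Ω → G) where
  toFun w :=
    { toFun := fun F x => F ((ψ w)⁻¹ x)
      invFun := fun F x => F (ψ w x)
      left_inv := fun F => by ext x; simp
      right_inv := fun F => by ext x; simp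
      map_mul' := fun F F' => rfl }
  map_one' := by ext F x; simp
  map_mul' w w' := by ext F x; simp

@[simp]
lemma funAct_apply (ψ : W →* Equiv.Perm Ω) (w : W) (F : Ω → G) (x : Ω) :
    funAct G ψ w F x = F ((ψ w)⁻¹ x) := rfl

variable {ψ : W →* Equiv.Perm Ω} (σ τ : (Ω → G) ⋊[funAct G ψ] W)

lemma altProd_right (k : ℕ) : (altProd σ τ k).right = altProd σ.right τ.right k :=
  map_altProd SemidirectProduct.rightHom σ τ k

lemma altProd_left_succ (k : ℕ) (x : Ω) :
    (altProd σ τ (k + 1)).left x = (altProd σ τ k).left x *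
      (if k % 2 = 0 then σ else τ).left ((ψ (altProd σ.right τ.right k))⁻¹ x) := by
  rw [altProd_succ, SemidirectProduct.mul_left, Pi.mul_apply, funAct_apply, altProd_right]

variable {σ τ}

lemma altProd_left_eq_altProd {x : Ω} {K : Subgroup W} {a b : G}
    (hσK : σ.right ∈ K) (hτK : τ.right ∈ K)
    (hσ : ∀ p ∈ K, σ.left ((ψ p)⁻¹ x) = a) (hτ : ∀ p ∈ K, τ.left ((ψ p)⁻¹ x) = b) (k : ℕ) :
    (altProd σ τ k).left x = altProd a b k := by
  induction k with
  | zero => simp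
  | succ k ih =>
    have hp := altProd_mem K hσK hτK k
    rw [altProd_left_succ, altProd_succ, ih]
    split_ifs
    · rw [hσ _ hp]
    · rw [hτ _ hp]

lemma altProd_left_eq_pow {x : Ω} {K : Subgroup W} {g : G} {χ : W → ℕ}
    (hσK : σ.right ∈ K) (hτK : τ.right ∈ K)
    (hσ : ∀ p ∈ K, σ.left ((ψ p)⁻¹ x) = g ^ χ (p * σ.right * p⁻¹))
    (hτ : ∀ p ∈ K, τ.left ((ψ p)⁻¹ x) = g ^ χ (p * τ.right * p⁻¹)) (k : ℕ) :
    (altProd σ τ k).left x = g ^ ∑ i ∈ Finset.range k,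
      χ (altProd σ.right τ.right (i + 1) * (altProd σ.right τ.right i)⁻¹) := by
  induction k with
  | zero => simp
  | succ k ih =>
    have hp := altProd_mem K hσK hτK k
    rw [altProd_left_succ, Finset.sum_range_succ, pow_add, ih, altProd_succ]
    split_ifs
    · rw [hσ _ hp]
    · rw [hτ _ hp]

/-- A braid relation holds at a point where both generators contribute powers of a single
element, counted by the reflections swept out. -/
lemma altProd_left_comm {x : Ω} {K : Subgroup W} {g : G} {χ : W → ℕ} {m : ℕ}
    (hσ1 : σ.right * σ.right = 1) (hτ1 : τ.right * τ.right = 1)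
    (hm : (σ.right * τ.right) ^ m = 1)
    (hσK : σ.right ∈ K) (hτK : τ.right ∈ K)
    (hσ : ∀ p ∈ K, σ.left ((ψ p)⁻¹ x) = g ^ χ (p * σ.right * p⁻¹))
    (hτ : ∀ p ∈ K, τ.left ((ψ p)⁻¹ x) = g ^ χ (p * τ.right * p⁻¹)) :
    (altProd σ τ m).left x = (altProd τ σ m).left x := by
  rw [altProd_left_eq_pow hσK hτK hσ hτ, altProd_left_eq_pow hτK hσK hτ hσ]
  congr 1
  rw [eq_comm, ← Finset.sum_range_reflect]
  exact Finset.sum_congr rfl fun i hi =>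
    congrArg χ (altProd_succ_mul_inv_reflect hσ1 hτ1 hm (Finset.mem_range.1 hi))

end Wreath

/-! ### The exchange condition in Coxeter groups -/

namespace CoxeterSystem

section Exchange

variable {B W : Type*} [Group W] {M : CoxeterMatrix B} (cs : CoxeterSystem M W)

/-- Conjugation as an action by permutations. -/
def conjPerm (W : Type*) [Group W] : W →* Equiv.Perm W :=
  (MulAut.toPerm W).comp MulAut.conj

@[simp]
lemma conjPerm_inv_apply (w x : W) : (conjPerm W w)⁻¹ x = w⁻¹ * x * w := by
  rw [← map_inv]
  change MulAut.conj w⁻¹ x = _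
  simp

open Classical in
/-- The image of a simple reflection in the group of signed functions of reflections. -/
noncomputable def signGen (i : B) : (W → ℤˣ) ⋊[funAct ℤˣ (conjPerm W)] W :=
  ⟨fun t => if t = cs.simple i then -1 else 1, cs.simple i⟩

lemma signGen_mul_self (i : B) : cs.signGen i * cs.signGen i = 1 := by
  refine SemidirectProduct.ext (funext fun t => ?_) (cs.simple_mul_simple_self i)
  have h : cs.simple i * t * cs.simple i = cs.simple i ↔ t = cs.simple i := by
    constructor
    · intro h
      have := congrArg (fun z => cs.simple i * z * cs.simple i) h
      simpa [mul_assoc] using this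
    · rintro rfl; simp
  by_cases ht : t = cs.simple i <;> simp [signGen, h, ht]

lemma signGen_isLiftable : M.IsLiftable cs.signGen := by
  intro i j
  rw [← altProd_comm_iff (cs.signGen_mul_self i) (cs.signGen_mul_self j)]
  have hm := cs.simple_mul_simple_pow i j
  refine SemidirectProduct.ext (funext fun t => ?_) ?_
  · classical
    have key : ∀ (k : B), ∀ p ∈ (⊤ : Subgroup W), (cs.signGen k).left ((conjPerm W p)⁻¹ t) =
        (-1 : ℤˣ) ^ (fun ρ => if t = ρ then 1 else 0) (p * (cs.signGen k).right * p⁻¹) := by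
      intro k p _
      have h : p⁻¹ * t * p = cs.simple k ↔ t = p * cs.simple k * p⁻¹ := by
        rw [eq_mul_inv_iff_mul_eq, mul_assoc, inv_mul_eq_iff_eq_mul]
      change (if (conjPerm W p)⁻¹ t = cs.simple k then (-1 : ℤˣ) else 1) =
        (-1) ^ (if t = p * cs.simple k * p⁻¹ then 1 else 0)
      simp only [conjPerm_inv_apply, h]
      split_ifs <;> simp
    exact altProd_left_comm (g := -1) (χ := fun ρ => if t = ρ then 1 else 0)
      (cs.simple_mul_simple_self i) (cs.simple_mul_simple_self j) hm
      (Subgroup.mem_top _) (Subgroup.mem_top _) (key i) (key j)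
  · rw [altProd_right, altProd_right]
    exact (altProd_comm_iff (cs.simple_mul_simple_self i) (cs.simple_mul_simple_self j) _).2 hm

/-- The sign cocycle on reflections. -/
noncomputable def signHom : W →* (W → ℤˣ) ⋊[funAct ℤˣ (conjPerm W)] W :=
  cs.lift ⟨cs.signGen, cs.signGen_isLiftable⟩

@[simp]
lemma signHom_simple (i : B) : cs.signHom (cs.simple i) = cs.signGen i :=
  cs.lift_apply_simple cs.signGen_isLiftable i

@[simp]
lemma signHom_right (w : W) : (cs.signHom w).right = w := by
  have : SemidirectProduct.rightHom.comp cs.signHom = MonoidHom.id W :=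
    cs.ext_simple fun i => by simp [signGen]
  exact DFunLike.congr_fun this w

lemma signHom_mul_left (w w' t : W) : (cs.signHom (w * w')).left t =
    (cs.signHom w).left t * (cs.signHom w').left (w⁻¹ * t * w) := by
  simp

lemma mem_leftInvSeq_of_signHom_ne_one (ω : List B) (t : W)
    (h : (cs.signHom (cs.wordProd ω)).left t ≠ 1) : t ∈ cs.leftInvSeq ω := by
  induction ω generalizing t with
  | nil => simp at h
  | cons i ω ih =>
    rw [wordProd_cons, signHom_mul_left] at h
    by_cases ht : t = cs.simple i
    · simp [leftInvSeq, ht]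
    · have h1 := ih ((cs.simple i)⁻¹ * t * cs.simple i) (by simpa [signGen, ht] using h)
      simp only [leftInvSeq, List.mem_cons, List.mem_map]
      exact Or.inr ⟨_, h1, by simp [mul_assoc]⟩

lemma signHom_reflection {t : W} (ht : cs.IsReflection t) : (cs.signHom t).left t = -1 := by
  obtain ⟨w, i, rfl⟩ := ht
  have h1 : (cs.signHom (w * w⁻¹)).left (w * cs.simple i * w⁻¹) = 1 := by simp
  rw [signHom_mul_left] at h1
  rw [mul_assoc w, signHom_mul_left, signHom_mul_left]
  have e1 : w⁻¹ * (w * (cs.simple i * w⁻¹)) * w = cs.simple i := by group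
  have e2 : w⁻¹ * (w * cs.simple i * w⁻¹) * w = cs.simple i := by group
  rw [e2] at h1
  rw [e1, inv_mul_cancel, one_mul, signHom_simple]
  have h2 : (cs.signGen i).left (cs.simple i) = -1 := by simp [signGen]
  rw [h2, mul_left_comm, ← mul_assoc w, h1, mul_one]

/-- The strong exchange condition. -/
theorem mem_leftInvSeq_of_isLeftInversion (ω : List B) {t : W}
    (h : cs.IsLeftInversion (cs.wordProd ω) t) : t ∈ cs.leftInvSeq ω := by
  refine cs.mem_leftInvSeq_of_signHom_ne_one ω t fun h1 => ?_
  obtain ⟨ht, hlt⟩ := h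
  obtain ⟨ω', hω', he⟩ := cs.exists_isReduced (t * cs.wordProd ω)
  have h2 : (cs.signHom (cs.wordProd ω')).left t ≠ 1 := by
    rw [← he, signHom_mul_left, cs.signHom_reflection ht, inv_mul_cancel, one_mul, h1]
    decide
  have h3 := (cs.isLeftInversion_of_mem_leftInvSeq hω'
    (cs.mem_leftInvSeq_of_signHom_ne_one ω' t h2)).2
  rw [← he, ← mul_assoc, ht.mul_self, one_mul] at h3
  omega

theorem exists_eraseIdx_of_isLeftInversion (ω : List B) {t : W}
    (h : cs.IsLeftInversion (cs.wordProd ω) t) :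
    ∃ j < ω.length, t * cs.wordProd ω = cs.wordProd (ω.eraseIdx j) := by
  obtain ⟨j, hj, rfl⟩ := List.mem_iff_getElem.mp (cs.mem_leftInvSeq_of_isLeftInversion ω h)
  refine ⟨j, by simpa using hj, ?_⟩
  rw [← List.getD_eq_getElem _ 1 hj, getD_leftInvSeq_mul_wordProd]

end Exchange

end CoxeterSystem

/-! ### Parabolic subgroups of Coxeter groups -/

namespace CoxeterSystem

section Parabolic

variable {B W : Type*} [Group W] {M : CoxeterMatrix B} (cs : CoxeterSystem M W)

/-- The standard parabolic subgroup of a Coxeter group. -/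
def parabolic (T : Set B) : Subgroup W := Subgroup.closure (cs.simple '' T)

variable {cs} {T X : Set B}

lemma simple_mem_parabolic {i : B} (hi : i ∈ T) : cs.simple i ∈ cs.parabolic T :=
  Subgroup.subset_closure ⟨i, hi, rfl⟩

lemma wordProd_mem_parabolic {ω : List B} (h : ∀ i ∈ ω, i ∈ T) :
    cs.wordProd ω ∈ cs.parabolic T := by
  refine Subgroup.list_prod_mem _ fun x hx => ?_
  obtain ⟨i, hi, rfl⟩ := List.mem_map.1 hx
  exact simple_mem_parabolic (h i hi)

lemma isLeftInversion_simple {w : W} {i : B}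
    (h : cs.length (cs.simple i * w) < cs.length w) : cs.IsLeftInversion w (cs.simple i) :=
  ⟨cs.isReflection_simple i, h⟩

lemma exists_reduced_simple_mul {ω : List B} (hω : cs.IsReduced ω) (hT : ∀ i ∈ ω, i ∈ T)
    {x : B} (hx : x ∈ T) :
    ∃ ω', cs.IsReduced ω' ∧ (∀ i ∈ ω', i ∈ T) ∧ cs.simple x * cs.wordProd ω = cs.wordProd ω' := by
  rcases cs.length_simple_mul (cs.wordProd ω) x with h | h
  · refine ⟨x :: ω, ?_, ?_, (cs.wordProd_cons x ω).symm⟩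
    · rw [IsReduced, wordProd_cons, h, hω.eq, List.length_cons]
    · simpa [hx] using hT
  · obtain ⟨j, hj, he⟩ := cs.exists_eraseIdx_of_isLeftInversion ω
      (isLeftInversion_simple (i := x) (by omega))
    refine ⟨ω.eraseIdx j, ?_, fun i hi => hT i (List.mem_of_mem_eraseIdx hi), he⟩
    rw [IsReduced, ← he]
    have := List.length_eraseIdx_add_one hj
    have := hω.eq
    omega

lemma exists_reduced_of_mem_parabolic {v : W} (hv : v ∈ cs.parabolic T) :
    ∃ ω, cs.IsReduced ω ∧ (∀ i ∈ ω, i ∈ T) ∧ v = cs.wordProd ω := by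
  induction hv using Subgroup.closure_induction_left with
  | one => exact ⟨[], by simp [IsReduced], by simp, by simp⟩
  | mul_left x hx y _ ih =>
    obtain ⟨i, hi, rfl⟩ := hx
    obtain ⟨ω, hω, hT, rfl⟩ := ih
    exact exists_reduced_simple_mul hω hT hi
  | inv_mul_cancel x hx y _ ih =>
    obtain ⟨i, hi, rfl⟩ := hx
    obtain ⟨ω, hω, hT, rfl⟩ := ih
    rw [inv_simple]
    exact exists_reduced_simple_mul hω hT hi

lemma exists_leftDescent_of_mem_parabolic {v : W} (hv : v ∈ cs.parabolic T) (h1 : v ≠ 1) :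
    ∃ i ∈ T, cs.length (cs.simple i * v) < cs.length v := by
  obtain ⟨ω, hω, hT, rfl⟩ := exists_reduced_of_mem_parabolic hv
  match ω, hω, hT, h1 with
  | [], _, _, h1 => simp at h1
  | i :: ω, hω, hT, _ =>
    refine ⟨i, hT i (by simp), ?_⟩
    have h2 := cs.length_wordProd_le ω
    rw [hω.eq, wordProd_cons, simple_mul_simple_cancel_left, List.length_cons]
    omega

lemma exists_rightDescent_of_mem_parabolic {v : W} (hv : v ∈ cs.parabolic T) (h1 : v ≠ 1) :
    ∃ i ∈ T, cs.length (v * cs.simple i) < cs.length v := by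
  obtain ⟨i, hi, h⟩ := exists_leftDescent_of_mem_parabolic (inv_mem hv) (inv_ne_one.2 h1)
  refine ⟨i, hi, ?_⟩
  rwa [← cs.length_inv (v * _), mul_inv_rev, inv_simple, ← cs.length_inv v]

lemma exists_simple_of_mem_parabolic {v : W} (hv : v ∈ cs.parabolic T)
    (h1 : cs.length v = 1) : ∃ i ∈ T, v = cs.simple i := by
  obtain ⟨ω, hω, hT, rfl⟩ := exists_reduced_of_mem_parabolic hv
  rw [hω.eq, List.length_eq_one_iff] at h1
  obtain ⟨i, rfl⟩ := h1
  exact ⟨i, hT i (by simp), by simp⟩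

/-- The exchange condition for a product `u * v` with `v` in a parabolic subgroup. -/
lemma exchange_mul {u v : W} (hv : v ∈ cs.parabolic T)
    (huv : cs.length (u * v) = cs.length u + cs.length v) {x : B}
    (h : cs.length (cs.simple x * (u * v)) < cs.length (u * v)) :
    cs.length (cs.simple x * u) < cs.length u ∨
      ∃ v' ∈ cs.parabolic T, cs.length v' < cs.length v ∧ cs.simple x * (u * v) = u * v' := by
  obtain ⟨ω₁, hω₁, rfl⟩ := cs.exists_isReduced u
  obtain ⟨ω₂, hω₂, hT, rfl⟩ := exists_reduced_of_mem_parabolic hv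
  rw [← wordProd_append] at h
  obtain ⟨j, hj, he⟩ := cs.exists_eraseIdx_of_isLeftInversion _ (isLeftInversion_simple h)
  rw [wordProd_append] at he
  rcases lt_or_ge j ω₁.length with hlt | hge
  · left
    rw [List.eraseIdx_append_of_lt_length hlt, wordProd_append, ← mul_assoc, mul_left_inj] at he
    have h1 := cs.length_wordProd_le (ω₁.eraseIdx j)
    have h2 := List.length_eraseIdx_add_one hlt
    rw [he, hω₁.eq]
    omega
  · right
    rw [List.eraseIdx_append_of_length_le hge, wordProd_append] at he
    refine ⟨_, wordProd_mem_parabolic fun i hi => hT i (List.mem_of_mem_eraseIdx hi), ?_, he⟩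
    rw [List.length_append] at hj
    have h1 := cs.length_wordProd_le (ω₂.eraseIdx (j - ω₁.length))
    have h2 := List.length_eraseIdx_add_one (l := ω₂) (i := j - ω₁.length) (by omega)
    rw [hω₂.eq]
    omega

variable (cs) in
/-- `w` has minimal length in the coset `W_X w`. -/
def LeftMinimal (X : Set B) (w : W) : Prop :=
  ∀ v ∈ cs.parabolic X, cs.length w ≤ cs.length (v * w)

lemma mem_parabolic_univ (w : W) : w ∈ cs.parabolic Set.univ := by
  rw [parabolic, Set.image_univ, subgroup_closure_range_simple]
  trivial

lemma LeftMinimal.length_mul {w v : W} (hw : cs.LeftMinimal X w) (hv : v ∈ cs.parabolic X) :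
    cs.length (v * w) = cs.length v + cs.length w := by
  obtain ⟨ω, hω, hT, rfl⟩ := exists_reduced_of_mem_parabolic hv
  clear hv
  induction ω with
  | nil => simp
  | cons i ω ih =>
    have hω' : cs.IsReduced ω := by simpa using hω.drop 1
    have hT' : ∀ i ∈ ω, i ∈ X := fun j hj => hT j (by simp [hj])
    specialize ih hω' hT'
    have e1 := hω.eq
    have e2 := hω'.eq
    rw [wordProd_cons, List.length_cons] at e1
    rw [wordProd_cons, mul_assoc]
    rcases cs.length_simple_mul (cs.wordProd ω * w) i with h | h
    · omega
    · exfalso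
      rcases exchange_mul (mem_parabolic_univ w) ih (x := i) (by omega) with h1 | ⟨w', -, h1, h2⟩
      · omega
      · have h3 := hw ((cs.wordProd ω)⁻¹ * cs.simple i * cs.wordProd ω)
          (mul_mem (mul_mem (inv_mem (wordProd_mem_parabolic hT'))
            (simple_mem_parabolic (hT i (by simp)))) (wordProd_mem_parabolic hT'))
        have h4 : (cs.wordProd ω)⁻¹ * cs.simple i * cs.wordProd ω * w = w' := by
          rw [mul_assoc, mul_assoc, h2, inv_mul_cancel_left]
        rw [h4] at h3
        omega

lemma LeftMinimal.length_mul_right {w v : W} (hw : cs.LeftMinimal X w⁻¹)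
    (hv : v ∈ cs.parabolic X) : cs.length (w * v) = cs.length w + cs.length v := by
  have := hw.length_mul (inv_mem hv)
  rwa [← mul_inv_rev, length_inv, length_inv, length_inv, add_comm] at this

lemma LeftMinimal.unique {w w' : W} (hw : cs.LeftMinimal X w) (hw' : cs.LeftMinimal X w')
    (h : w' * w⁻¹ ∈ cs.parabolic X) : w' = w := by
  have h1 := hw.length_mul h
  have h2 := hw' _ (inv_mem h)
  rw [inv_mul_cancel_right] at h1
  rw [mul_inv_rev, inv_inv, inv_mul_cancel_right] at h2
  have h3 : cs.length (w' * w⁻¹) = 0 := by omega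
  exact mul_inv_eq_one.1 (cs.length_eq_zero_iff.1 h3)

variable (cs) in
/-- The condition defining a shortest representative of `W_X u`. -/
def IsRep (X : Set B) (u r : W) : Prop := r * u⁻¹ ∈ cs.parabolic X ∧ cs.LeftMinimal X r

lemma exists_minimal_doubleCoset (X T : Set B) (u : W) :
    ∃ v ∈ cs.parabolic X, ∃ y ∈ cs.parabolic T,
      cs.LeftMinimal X (v * u * y) ∧ cs.LeftMinimal T (v * u * y)⁻¹ := by
  let D : Set W := {w | ∃ v ∈ cs.parabolic X, ∃ y ∈ cs.parabolic T, w = v * u * y}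
  have hD : D.Nonempty := ⟨u, 1, one_mem _, 1, one_mem _, by simp⟩
  obtain ⟨v, hv, y, hy, he⟩ := Function.argminOn_mem cs.length D hD
  have hmin : ∀ w ∈ D, cs.length (v * u * y) ≤ cs.length w := fun w hw => by
    rw [← he]; exact Function.argminOn_le cs.length D hw
  refine ⟨v, hv, y, hy, fun v' hv' => ?_, fun y' hy' => ?_⟩
  · exact hmin _ ⟨v' * v, mul_mem hv' hv, y, hy, by simp only [mul_assoc]⟩
  · rw [length_inv, ← cs.length_inv (y' * _), mul_inv_rev, inv_inv]
    exact hmin _ ⟨v, hv, y * y'⁻¹, mul_mem hy (inv_mem hy'), by simp only [mul_assoc]⟩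

lemma exists_isRep (X : Set B) (u : W) : ∃ r, cs.IsRep X u r := by
  obtain ⟨v, hv, y, hy, h, -⟩ := exists_minimal_doubleCoset (cs := cs) X ∅ u
  have hy1 : y = 1 := by simpa [parabolic] using hy
  subst hy1
  exact ⟨_, by simpa using hv, h⟩

variable (cs) in
/-- The shortest element of `W_X u`. -/
noncomputable def rep (X : Set B) (u : W) : W := (exists_isRep (cs := cs) X u).choose

lemma isRep_rep (X : Set B) (u : W) : cs.IsRep X u (cs.rep X u) :=
  (exists_isRep X u).choose_spec

lemma rep_eq {u r : W} (h : r * u⁻¹ ∈ cs.parabolic X) (hr : cs.LeftMinimal X r) :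
    cs.rep X u = r := by
  refine LeftMinimal.unique hr (isRep_rep X u).2 ?_
  have := mul_mem (isRep_rep X u).1 (inv_mem h)
  simpa [mul_assoc] using this

lemma rep_mul_left {v : W} (hv : v ∈ cs.parabolic X) (u : W) :
    cs.rep X (v * u) = cs.rep X u := by
  refine rep_eq ?_ (isRep_rep X u).2
  have := mul_mem (isRep_rep X u).1 (inv_mem hv)
  simpa [mul_assoc] using this

lemma exists_rep_mul_simple {u : W} {s : B} (h : u * cs.simple s * u⁻¹ ∈ cs.parabolic X) :
    ∃ x ∈ X, cs.rep X u * cs.simple s = cs.simple x * cs.rep X u := by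
  obtain ⟨hr, hmin⟩ := isRep_rep (cs := cs) X u
  set r := cs.rep X u
  have h1 : r * cs.simple s * r⁻¹ ∈ cs.parabolic X := by
    have := mul_mem (mul_mem hr h) (inv_mem hr)
    simpa [mul_assoc] using this
  have h2 := hmin.length_mul h1
  have h3 := cs.length_mul_le r (cs.simple s)
  rw [inv_mul_cancel_right] at h2
  rw [length_simple] at h3
  have h4 : cs.length (r * cs.simple s * r⁻¹) ≠ 0 := by
    rw [Ne, cs.length_eq_zero_iff, mul_inv_eq_one, mul_eq_left]
    intro h
    have := cs.length_simple s
    rw [h, length_one] at this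
    omega
  obtain ⟨x, hx, he⟩ := exists_simple_of_mem_parabolic h1 (by omega)
  exact ⟨x, hx, mul_inv_eq_iff_eq_mul.1 he⟩

lemma mem_parabolic_of_rep_mul_simple {u : W} {s x : B} (hx : x ∈ X)
    (h : cs.rep X u * cs.simple s = cs.simple x * cs.rep X u) :
    u * cs.simple s * u⁻¹ ∈ cs.parabolic X := by
  have hr := (isRep_rep (cs := cs) X u).1
  have := mul_mem (mul_mem (inv_mem hr) (simple_mem_parabolic hx)) hr
  have e : u * cs.simple s * u⁻¹ = (cs.rep X u * u⁻¹)⁻¹ * cs.simple x * (cs.rep X u * u⁻¹) := by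
    rw [mul_assoc _ (cs.simple x), ← mul_assoc (cs.simple x), ← h]
    group
  rwa [e]

/-- The stabilizer of a coset of minimal representative `w` is generated by the simple
reflections it contains. -/
lemma mem_closure_of_mul_eq {w : W} (hX : cs.LeftMinimal X w) (hT : cs.LeftMinimal T w⁻¹)
    {y : W} (hy : y ∈ cs.parabolic T) (h : w * y * w⁻¹ ∈ cs.parabolic X) :
    y ∈ Subgroup.closure (cs.simple ''
      {t | t ∈ T ∧ ∃ x ∈ X, cs.simple x * w = w * cs.simple t}) := by
  induction hn : cs.length y using Nat.strong_induction_on generalizing y with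
  | _ n ih =>
    by_cases hy1 : y = 1
    · rw [hy1]; exact one_mem _
    obtain ⟨x, hx, hlt⟩ := exists_leftDescent_of_mem_parabolic h (by simpa using hy1)
    have hl := hT.length_mul_right hy
    have hl' : cs.length (cs.simple x * (w * y)) < cs.length (w * y) := by
      have e1 := hX.length_mul h
      have e2 := hX.length_mul (mul_mem (simple_mem_parabolic hx) h)
      rw [inv_mul_cancel_right] at e1
      rw [mul_assoc, inv_mul_cancel_right] at e2
      omega
    rcases exchange_mul hy hl hl' with h1 | ⟨y', hy', h1, h2⟩
    · have := hX _ (simple_mem_parabolic hx)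
      omega
    have h3 : y' * y⁻¹ ∈ cs.parabolic T := mul_mem hy' (inv_mem hy)
    have h4 : cs.simple x * w = w * (y' * y⁻¹) := by
      rw [← mul_assoc, ← h2]; group
    have h5 : cs.length (y' * y⁻¹) = 1 := by
      have e1 := hT.length_mul_right h3
      have e2 := hX.length_mul (simple_mem_parabolic hx)
      rw [← h4, e2, length_simple] at e1
      omega
    obtain ⟨t, ht, he⟩ := exists_simple_of_mem_parabolic h3 h5
    have h6 := ih _ (hn ▸ h1) hy' (by
      rw [← h2, mul_assoc]
      exact mul_mem (simple_mem_parabolic hx) h) rfl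
    have h7 : y = (cs.simple t)⁻¹ * y' := by rw [← he]; group
    rw [h7]
    exact mul_mem (inv_mem (Subgroup.subset_closure ⟨t, ⟨ht, x, hx, he ▸ h4⟩, rfl⟩)) h6

end Parabolic

end CoxeterSystem

/-! ### Coxeter groups of large type -/

namespace CoxeterSystem

section Large

variable {B W : Type*} [Group W] {M : CoxeterMatrix B} {cs : CoxeterSystem M W} {T X : Set B}

lemma exists_mul_leftMinimal_inv (T : Set B) (x : W) :
    ∃ z, ∃ y ∈ cs.parabolic T, cs.LeftMinimal T z⁻¹ ∧ x = z * y := by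
  obtain ⟨h1, h2⟩ := isRep_rep (cs := cs) T x⁻¹
  exact ⟨(cs.rep T x⁻¹)⁻¹, _, h1, by rwa [inv_inv], by group⟩

lemma IsRightDescent.exists_mul {s t : B} {x : W} (hs : cs.IsRightDescent x s)
    (ht : cs.IsRightDescent x t) : ∃ z, ∃ y ∈ cs.parabolic {s, t}, cs.LeftMinimal {s, t} z⁻¹ ∧
      x = z * y ∧ cs.IsRightDescent y s ∧ cs.IsRightDescent y t := by
  obtain ⟨z, y, hy, hz, rfl⟩ := exists_mul_leftMinimal_inv (cs := cs) {s, t} x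
  refine ⟨z, y, hy, hz, rfl, ?_, ?_⟩
  · have h1 := hz.length_mul_right hy
    have h2 := hz.length_mul_right (mul_mem hy (simple_mem_parabolic (i := s) (by simp)))
    rw [IsRightDescent, mul_assoc] at hs
    rw [IsRightDescent]
    omega
  · have h1 := hz.length_mul_right hy
    have h2 := hz.length_mul_right (mul_mem hy (simple_mem_parabolic (i := t) (by simp)))
    rw [IsRightDescent, mul_assoc] at ht
    rw [IsRightDescent]
    omega

lemma isRightDescent_mul_of_leftMinimal {z y : W} {s : B} (hz : cs.LeftMinimal T z⁻¹)
    (hy : y ∈ cs.parabolic T) (hs : s ∈ T) (h : cs.IsRightDescent y s) :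
    cs.IsRightDescent (z * y) s := by
  have h1 := hz.length_mul_right hy
  have h2 := hz.length_mul_right (mul_mem hy (simple_mem_parabolic hs))
  rw [IsRightDescent] at h
  rw [IsRightDescent, mul_assoc]
  omega

lemma not_isRightDescent_mul_simple {x : W} {s : B} (h : cs.IsRightDescent x s) :
    ¬ cs.IsRightDescent (x * cs.simple s) s := by
  rw [IsRightDescent, simple_mul_simple_cancel_right]
  exact not_lt_of_gt h

lemma IsRightDescent.other_of_mem {s t : B} {y : W} (hy : y ∈ cs.parabolic {s, t})
    (h1 : y ≠ 1) (hs : ¬ cs.IsRightDescent y s) : cs.IsRightDescent y t := by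
  obtain ⟨i, hi, h⟩ := exists_rightDescent_of_mem_parabolic hy h1
  rcases hi with rfl | rfl
  · exact absurd h hs
  · exact h

lemma IsRightDescent.mul_simple (hnc : ∀ i j : B, i ≠ j →
      cs.simple i * cs.simple j ≠ cs.simple j * cs.simple i) {s t : B} (hst : s ≠ t) {x : W}
    (hs : cs.IsRightDescent x s) (ht : cs.IsRightDescent x t) :
    cs.IsRightDescent (x * cs.simple s) t ∧
      cs.IsRightDescent (x * cs.simple s * cs.simple t) s := by
  obtain ⟨z, y, hy, hz, rfl, hs, ht⟩ := hs.exists_mul ht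
  have hsm : cs.simple s ∈ cs.parabolic {s, t} := simple_mem_parabolic (by simp)
  have htm : cs.simple t ∈ cs.parabolic {s, t} := simple_mem_parabolic (by simp)
  have h1 : y * cs.simple s ≠ 1 := by
    intro h
    have hys : y = cs.simple s := by rw [mul_eq_one_iff_eq_inv.1 h, inv_simple]
    subst hys
    rw [IsRightDescent, length_simple, Nat.lt_one_iff, length_eq_zero_iff] at ht
    refine hnc s t hst ?_
    rw [mul_eq_one_iff_eq_inv.1 ht, inv_simple]
  have h2 : cs.IsRightDescent (y * cs.simple s) t :=
    IsRightDescent.other_of_mem (mul_mem hy hsm) h1 (not_isRightDescent_mul_simple hs)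
  have h3 : y * cs.simple s * cs.simple t ≠ 1 := by
    intro h
    have e1 := cs.isRightDescent_iff.1 hs
    have e2 := cs.isRightDescent_iff.1 ht
    have e3 := cs.isRightDescent_iff.1 h2
    rw [h, length_one] at e3
    obtain ⟨i, hi, he⟩ := exists_simple_of_mem_parabolic (mul_mem hy htm) (by omega)
    have hys : y = cs.simple t * cs.simple s := by
      rw [mul_assoc] at h
      rw [mul_eq_one_iff_eq_inv.1 h, mul_inv_rev, inv_simple, inv_simple]
    have he' := eq_mul_inv_of_mul_eq he
    rw [inv_simple, hys] at he'
    rcases hi with rfl | rfl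
    · exact hnc _ _ hst he'.symm
    · rw [simple_mul_simple_self, mul_eq_one_iff_eq_inv, inv_simple] at he'
      exact hnc _ _ hst (by rw [he'])
  have hst' : t ∈ ({s, t} : Set B) := by simp
  have hs' : s ∈ ({s, t} : Set B) := by simp
  rw [mul_assoc z, mul_assoc z]
  refine ⟨isRightDescent_mul_of_leftMinimal hz (mul_mem hy hsm) hst' h2,
    isRightDescent_mul_of_leftMinimal hz (mul_mem (mul_mem hy hsm) htm) hs' ?_⟩
  refine IsRightDescent.other_of_mem ?_ h3 (not_isRightDescent_mul_simple h2)
  rw [Set.pair_comm]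
  exact mul_mem (mul_mem hy hsm) htm

lemma not_isRightDescent_triangle (hnc : ∀ i j : B, i ≠ j →
      cs.simple i * cs.simple j ≠ cs.simple j * cs.simple i) {a b c : B} (hab : a ≠ b)
    (hbc : b ≠ c) (hac : a ≠ c) {x : W} (h1 : cs.IsRightDescent x a)
    (h2 : cs.IsRightDescent x b) (h3 : cs.IsRightDescent (x * cs.simple a) b)
    (h4 : cs.IsRightDescent (x * cs.simple a) c) : False := by
  induction hn : cs.length x using Nat.strong_induction_on generalizing x a b c with
  | _ n ih =>
    exact ih _ (hn ▸ h1) hbc hac.symm hab.symm h3 h4 (h3.mul_simple hnc hbc h4).1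
      (h1.mul_simple hnc hab h2).2 rfl

/-- In large type, two simple reflections are carried to simple reflections only by the
trivial element. -/
lemma eq_one_of_mul_simple_eq (hnc : ∀ i j : B, i ≠ j →
      cs.simple i * cs.simple j ≠ cs.simple j * cs.simple i) {s t s' t' : B} (hst : s ≠ t)
    {w : W} (hs : ¬ cs.IsRightDescent w s) (ht : ¬ cs.IsRightDescent w t)
    (hs' : cs.simple s' * w = w * cs.simple s) (ht' : cs.simple t' * w = w * cs.simple t) :
    w = 1 := by
  by_contra h1
  obtain ⟨r, hr⟩ := cs.exists_rightDescent_of_ne_one h1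
  have hrs : r ≠ s := by rintro rfl; exact hs hr
  have hrt : r ≠ t := by rintro rfl; exact ht hr
  have key : ∀ s s' : B, ¬ cs.IsRightDescent w s → cs.simple s' * w = w * cs.simple s →
      cs.IsRightDescent (w * cs.simple s) s ∧ cs.IsRightDescent (w * cs.simple s) r := by
    intro s s' hs hs'
    have e1 := cs.not_isRightDescent_iff.1 hs
    have e2 := cs.isRightDescent_iff.1 hr
    have e3 := cs.length_mul_le (cs.simple s') (w * cs.simple r)
    rw [length_simple] at e3
    constructor
    · rw [IsRightDescent, simple_mul_simple_cancel_right]; omega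
    · rw [IsRightDescent]
      conv_lhs => rw [← hs', mul_assoc]
      omega
  obtain ⟨a1, a2⟩ := key s s' hs hs'
  obtain ⟨b1, b2⟩ := key t t' ht ht'
  obtain ⟨c1, c2⟩ := a2.mul_simple hnc hrs a1
  have d1 := (b1.mul_simple hnc hrt.symm b2).2
  rw [simple_mul_simple_cancel_right] at d1
  have e1 := cs.not_isRightDescent_iff.1 hs
  have e2 := cs.isRightDescent_iff.1 hr
  have e3 := cs.isRightDescent_iff.1 d1
  have e4 := cs.isRightDescent_iff.1 a2
  have d2 : cs.IsRightDescent (w * cs.simple s * cs.simple r) t := by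
    have e5 := cs.length_mul_le (cs.simple s') (w * cs.simple r * cs.simple t)
    rw [length_simple] at e5
    rw [IsRightDescent]
    conv_lhs => rw [← hs', mul_assoc, mul_assoc, ← mul_assoc w]
    omega
  exact not_isRightDescent_triangle hnc hst hrt.symm hrs.symm c1 d2
    (c1.mul_simple hnc hst d2).1 c2

lemma mem_closure_simple_of_subsingleton {Z : Set B} (hZ : Z.Subsingleton) {y : W}
    (hy : y ∈ Subgroup.closure (cs.simple '' Z)) : y = 1 ∨ ∃ z ∈ Z, y = cs.simple z := by
  induction hy using Subgroup.closure_induction_left with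
  | one => exact Or.inl rfl
  | mul_left x hx y _ ih =>
    obtain ⟨i, hi, rfl⟩ := hx
    rcases ih with rfl | ⟨z, hz, rfl⟩
    · exact Or.inr ⟨i, hi, mul_one _⟩
    · rw [hZ hi hz, simple_mul_simple_self]; exact Or.inl rfl
  | inv_mul_cancel x hx y _ ih =>
    obtain ⟨i, hi, rfl⟩ := hx
    rw [inv_simple]
    rcases ih with rfl | ⟨z, hz, rfl⟩
    · exact Or.inr ⟨i, hi, mul_one _⟩
    · rw [hZ hi hz, simple_mul_simple_self]; exact Or.inl rfl

lemma simple_ne_one (i : B) : cs.simple i ≠ 1 := by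
  intro h
  have := cs.length_simple i
  rw [h, length_one] at this
  omega

lemma leftMinimal_mul_of_stabilizer {w : W} (hX : cs.LeftMinimal X w)
    (hT : cs.LeftMinimal T w⁻¹) {z : B}
    (hst : ∀ y ∈ cs.parabolic T, w * y * w⁻¹ ∈ cs.parabolic X → y = 1 ∨ y = cs.simple z)
    {y : W} (hy : y ∈ cs.parabolic T) (hlt : cs.length y < cs.length (cs.simple z * y)) :
    cs.rep X (w * y) = w * y := by
  obtain ⟨h1, h2⟩ := isRep_rep (cs := cs) X (w * y)
  set r := cs.rep X (w * y)
  have hv : w * y * r⁻¹ ∈ cs.parabolic X := by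
    have := inv_mem h1
    rwa [mul_inv_rev, inv_inv] at this
  by_contra hne
  obtain ⟨x, hx, hlx⟩ := exists_leftDescent_of_mem_parabolic hv
    fun h => hne (mul_inv_eq_one.1 h).symm
  have e1 := h2.length_mul hv
  have e2 := h2.length_mul (mul_mem (simple_mem_parabolic hx) hv)
  rw [inv_mul_cancel_right] at e1
  rw [mul_assoc, inv_mul_cancel_right] at e2
  rcases exchange_mul hy (hT.length_mul_right hy) (x := x) (by omega) with h | ⟨y', hy', hl, he⟩
  · have := hX _ (simple_mem_parabolic hx)
    omega
  · have e : w * (y' * y⁻¹) * w⁻¹ = cs.simple x := by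
      rw [← mul_assoc w, ← he]; group
    rcases hst _ (mul_mem hy' (inv_mem hy)) (e ▸ simple_mem_parabolic hx) with h | h
    · rw [mul_inv_eq_one.1 h] at hl; omega
    · rw [mul_inv_eq_iff_eq_mul.1 h] at hl; omega

/-- If at most one simple reflection of `T` stabilizes the coset of the double coset
representative `w`, all fixed cosets in its `W_T`-orbit carry the same label. -/
lemma exists_simple_mul_eq {w : W} (hX : cs.LeftMinimal X w) (hT : cs.LeftMinimal T w⁻¹)
    (hZ : {t | t ∈ T ∧ ∃ x ∈ X, cs.simple x * w = w * cs.simple t}.Subsingleton) {y : W}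
    (hy : y ∈ cs.parabolic T) {s x : B} (hs : s ∈ T) (hx : x ∈ X)
    (h : cs.rep X (w * y) * cs.simple s = cs.simple x * cs.rep X (w * y)) :
    ∃ z ∈ T, cs.simple x * w = w * cs.simple z := by
  have hst := fun (y : W) (hy : y ∈ cs.parabolic T) h =>
    mem_closure_simple_of_subsingleton hZ (mem_closure_of_mul_eq hX hT hy h)
  have h1 := hst (y * cs.simple s * y⁻¹)
    (mul_mem (mul_mem hy (simple_mem_parabolic hs)) (inv_mem hy)) (by
      have := mem_parabolic_of_rep_mul_simple hx h
      simpa [mul_assoc] using this)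
  obtain ⟨z, hz, he⟩ := h1.resolve_left fun h => by
    rw [mul_inv_eq_one, mul_eq_left] at h
    exact simple_ne_one s h
  have hst' : ∀ y ∈ cs.parabolic T, w * y * w⁻¹ ∈ cs.parabolic X → y = 1 ∨ y = cs.simple z := by
    intro y hy h
    rcases hst y hy h with h | ⟨z', hz', h⟩
    · exact Or.inl h
    · exact Or.inr (by rw [h, hZ hz hz'])
  obtain ⟨hzT, x0, hx0, h0⟩ := hz
  rw [mul_inv_eq_iff_eq_mul] at he
  refine ⟨z, hzT, ?_⟩
  rcases cs.length_simple_mul y z with hl | hl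
  · rw [leftMinimal_mul_of_stabilizer hX hT hst' hy (by omega), mul_assoc, he] at h
    rw [← mul_left_inj y, mul_assoc, mul_assoc, h]
  · have h2 : cs.rep X (w * (cs.simple z * y)) = cs.rep X (w * y) := by
      rw [← mul_assoc, ← h0, mul_assoc, rep_mul_left (simple_mem_parabolic hx0)]
    have h3 := leftMinimal_mul_of_stabilizer hX hT hst'
      (mul_mem (simple_mem_parabolic hzT) hy) (by rw [simple_mul_simple_cancel_left]; omega)
    rw [← h2, h3, mul_assoc, mul_assoc, he, simple_mul_simple_cancel_left] at h
    rw [← mul_left_inj (cs.simple z * y), mul_assoc, ← h, mul_assoc, simple_mul_simple_cancel_left]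

end Large

end CoxeterSystem

/-! ### Noncommuting simple reflections -/

section CosRep

open Polynomial.Chebyshev Real

lemma eval_chebyshev_S_eq_zero {m : ℕ} {θ : ℝ} (hm : m * θ = 2 * π) (hθ : sin θ ≠ 0) :
    (S ℝ ((m - 2) / 2)).eval (2 * cos θ) * ((S ℝ ((m - 1) / 2)).eval (2 * cos θ) +
        (S ℝ ((m - 3) / 2)).eval (2 * cos θ)) = 0 ∧
      (S ℝ ((m - 1) / 2)).eval (2 * cos θ) * ((S ℝ (m / 2)).eval (2 * cos θ) +
        (S ℝ ((m - 2) / 2)).eval (2 * cos θ)) = 0 := by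
  obtain ⟨j, rfl | rfl⟩ := Nat.even_or_odd' m
  · push_cast at hm ⊢
    rw [show (2 * (j : ℤ) - 2) / 2 = j - 1 by omega, show (2 * (j : ℤ) - 1) / 2 = j - 1 by omega]
    have h : (S ℝ ((j : ℤ) - 1)).eval (2 * cos θ) = 0 := by
      have := S_two_mul_real_cos θ ((j : ℤ) - 1)
      push_cast at this
      rw [sub_add_cancel, show (j : ℝ) * θ = π by linarith, sin_pi] at this
      exact (mul_eq_zero.1 this).resolve_right hθ
    simp [h]
  · push_cast at hm ⊢
    rw [show (2 * (j : ℤ) + 1 - 2) / 2 = j - 1 by omega,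
      show (2 * (j : ℤ) + 1 - 1) / 2 = j by omega, show (2 * (j : ℤ) + 1 - 3) / 2 = j - 1 by omega,
      show (2 * (j : ℤ) + 1) / 2 = j by omega]
    have h : (S ℝ (j : ℤ)).eval (2 * cos θ) + (S ℝ ((j : ℤ) - 1)).eval (2 * cos θ) = 0 := by
      have h1 := S_two_mul_real_cos θ ((j : ℤ) - 1)
      have h2 := S_two_mul_real_cos θ (j : ℤ)
      push_cast at h1 h2
      rw [sub_add_cancel] at h1
      rw [show ((j : ℝ) + 1) * θ = 2 * π - j * θ by linarith, sin_two_pi_sub] at h2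
      refine (mul_eq_zero.1 ?_).resolve_right hθ
      rw [add_mul, h1, h2, neg_add_cancel]
    simp [h]

namespace CoxeterMatrix

variable {B : Type*} (M : CoxeterMatrix B)

/-- The vector of the cosine form attached to a generator. -/
noncomputable def cosRow (s : B) : B → ℝ := fun r => -2 * cos (π / M s r)

lemma proj_cosRow_self (s : B) : (LinearMap.proj s : (B → ℝ) →ₗ[ℝ] ℝ) (M.cosRow s) = 2 := by
  simp [cosRow]

/-- The dual geometric representation on generators. -/
noncomputable def cosRefl (s : B) : (B → ℝ) ≃ₗ[ℝ] (B → ℝ) :=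
  Module.reflection (M.proj_cosRow_self s)

lemma cosRefl_mul_self (s : B) : M.cosRefl s * M.cosRefl s = 1 :=
  LinearEquiv.ext fun v => Module.involutive_reflection _ v

lemma cosRefl_isLiftable : M.IsLiftable M.cosRefl := by
  intro s t
  by_cases hst : s = t
  · subst hst
    rw [M.diagonal, pow_one, cosRefl_mul_self]
  have h1 := M.off_diagonal s t hst
  by_cases h0 : M s t = 0
  · rw [h0, pow_zero]
  by_cases h2 : M s t = 2
  · have e : M t s = 2 := by rw [M.symmetric, h2]
    ext v r
    rw [h2, sq]
    simp [cosRefl, Module.reflection_apply, cosRow, h2, e]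
    ring
  have h3 : (3 : ℝ) ≤ M s t := by
    have : 3 ≤ M s t := by omega
    exact_mod_cast this
  have hθ : sin (2 * π / M s t) ≠ 0 := by
    refine (sin_pos_of_pos_of_lt_pi (by positivity) ?_).ne'
    rw [div_lt_iff₀ (by linarith)]
    nlinarith [pi_pos]
  obtain ⟨c1, c2⟩ := eval_chebyshev_S_eq_zero (m := M s t) (θ := 2 * π / M s t)
    (by field_simp) hθ
  refine LinearEquiv.ext fun v => ?_
  rw [cosRefl, cosRefl, Module.reflection_mul_reflection_pow_apply _ _ _ _
    (2 * cos (2 * π / M s t)) ?_, c1, c2]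
  · simp
  · have e : (2 * π / M s t : ℝ) = 2 * (π / M s t) := by ring
    rw [e, cos_two_mul]
    simp [cosRow, M.symmetric t s]
    ring

end CoxeterMatrix

lemma CoxeterSystem.simple_mul_simple_ne {B W : Type*} [Group W] {M : CoxeterMatrix B}
    (cs : CoxeterSystem M W) {s t : B} (hst : s ≠ t) (h2 : M s t ≠ 2) :
    cs.simple s * cs.simple t ≠ cs.simple t * cs.simple s := by
  intro h
  have h1 := congrArg (cs.lift ⟨M.cosRefl, M.cosRefl_isLiftable⟩) h
  rw [map_mul, map_mul, cs.lift_apply_simple, cs.lift_apply_simple] at h1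
  have hc : cos (π / M s t) ≠ 0 := by
    have h1 := M.off_diagonal s t hst
    by_cases h0 : M s t = 0
    · simp [h0]
    have h3 : (3 : ℝ) ≤ M s t := by
      have : 3 ≤ M s t := by omega
      exact_mod_cast this
    refine (cos_pos_of_mem_Ioo ⟨?_, ?_⟩).ne'
    · have : 0 < π / M s t := by positivity
      linarith [pi_pos]
    · rw [div_lt_div_iff₀ (by linarith) (by norm_num)]
      nlinarith [pi_pos]
  classical
  have h4 := congrFun (LinearEquiv.congr_fun h1 (Pi.single s 1)) t
  simp [CoxeterMatrix.cosRefl, Module.reflection_apply, hst.symm, CoxeterMatrix.cosRow] at h4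
  exact hc (by linarith)

end CosRep

/-! ### A crossed homomorphism on an Artin group -/

/-- The action of a group on itself by right translations. -/
def rightPerm (W : Type*) [Group W] : W →* Equiv.Perm W where
  toFun w := Equiv.mulRight w⁻¹
  map_one' := by ext; simp
  map_mul' w w' := by ext; simp [mul_assoc]

lemma rightPerm_inv_apply {W : Type*} [Group W] (w u : W) : (rightPerm W w)⁻¹ u = u * w := by
  rw [Equiv.Perm.inv_eq_iff_eq]
  simp [rightPerm]

namespace CoxeterSystem

section Label

variable {B W G : Type*} [Group W] [Group G] {C : CoxeterMatrix B} (cs : CoxeterSystem C W)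
  (X : Set B) (f : B → G)

open Classical in
/-- The label of the edge from `W_X u` to `W_X u s`: loops are labelled by `f x` for the
generator `x` of `W_X` corresponding to `s`, other edges by `1`. -/
noncomputable def label (u : W) (s : B) : G :=
  if h : ∃ x ∈ X, cs.rep X u * cs.simple s = cs.simple x * cs.rep X u then f h.choose else 1

variable {cs X}

lemma simple_inj (hnc : ∀ i j : B, i ≠ j →
      cs.simple i * cs.simple j ≠ cs.simple j * cs.simple i) {x x' : B}
    (h : cs.simple x = cs.simple x') : x = x' := by
  by_contra hne
  exact hnc _ _ hne (by rw [h])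

lemma label_eq (hnc : ∀ i j : B, i ≠ j →
      cs.simple i * cs.simple j ≠ cs.simple j * cs.simple i) {u : W} {s x : B} (hx : x ∈ X)
    (h : cs.rep X u * cs.simple s = cs.simple x * cs.rep X u) : cs.label X f u s = f x := by
  have h' : ∃ x ∈ X, cs.rep X u * cs.simple s = cs.simple x * cs.rep X u := ⟨x, hx, h⟩
  rw [label, dif_pos h']
  congr 1
  exact simple_inj hnc (mul_right_cancel (h'.choose_spec.2.symm.trans h))

lemma label_of_notMem {u : W} {s : B} (h : u * cs.simple s * u⁻¹ ∉ cs.parabolic X) :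
    cs.label X f u s = 1 := by
  rw [label, dif_neg]
  rintro ⟨x, hx, he⟩
  exact h (mem_parabolic_of_rep_mul_simple hx he)

lemma label_mul_left {v : W} (hv : v ∈ cs.parabolic X) (u : W) (s : B) :
    cs.label X f (v * u) s = cs.label X f u s := by
  rw [label, label, rep_mul_left hv]

lemma label_of_mem (hnc : ∀ i j : B, i ≠ j →
      cs.simple i * cs.simple j ≠ cs.simple j * cs.simple i) {v : W}
    (hv : v ∈ cs.parabolic X) {s : B} (hs : s ∈ X) : cs.label X f v s = f s := by
  have h1 : cs.rep X v = 1 :=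
    rep_eq (by simpa using hv) fun v' _ => by simp
  refine label_eq f hnc hs ?_
  rw [h1, mul_one, one_mul]

lemma label_mem (K : Subgroup G) (hK : ∀ x ∈ X, f x ∈ K) (u : W) (s : B) :
    cs.label X f u s ∈ K := by
  rw [label]
  split_ifs with h
  · exact hK _ h.choose_spec.1
  · exact one_mem K

open Classical in
/-- If at most one generator of `T` stabilizes `W_X w`, then all the loops in the `W_T`-orbit of
`W_X w` have the same label. -/
lemma exists_label_eq_pow (hnc : ∀ i j : B, i ≠ j →
      cs.simple i * cs.simple j ≠ cs.simple j * cs.simple i) {T : Set B} {w : W}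
    (hX : cs.LeftMinimal X w) (hT : cs.LeftMinimal T w⁻¹)
    (hZ : {t | t ∈ T ∧ ∃ x ∈ X, cs.simple x * w = w * cs.simple t}.Subsingleton) :
    ∃ g, (g = 1 ∨ ∃ x ∈ X, g = f x) ∧ ∀ y ∈ cs.parabolic T, ∀ s ∈ T, cs.label X f (w * y) s =
      g ^ (if w * y * cs.simple s * (w * y)⁻¹ ∈ cs.parabolic X then 1 else 0) := by
  by_cases h : ∃ x ∈ X, ∃ z ∈ T, cs.simple x * w = w * cs.simple z
  · obtain ⟨x, hx, z, hz, h⟩ := h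
    refine ⟨f x, Or.inr ⟨x, hx, rfl⟩, fun y hy s hs => ?_⟩
    split_ifs with hp
    · obtain ⟨x', hx', he⟩ := exists_rep_mul_simple hp
      obtain ⟨z', hz', h'⟩ := exists_simple_mul_eq hX hT hZ hy hs hx' he
      have hzz : z' = z := hZ ⟨hz', x', hx', h'⟩ ⟨hz, x, hx, h⟩
      rw [hzz, ← h, mul_left_inj] at h'
      rw [label_eq f hnc hx' he, simple_inj hnc h', pow_one]
    · rw [label_of_notMem f hp, pow_zero]
  · refine ⟨1, Or.inl rfl, fun y hy s hs => ?_⟩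
    rw [one_pow]
    refine label_of_notMem f fun hp => h ?_
    obtain ⟨x', hx', he⟩ := exists_rep_mul_simple hp
    obtain ⟨z', hz', h'⟩ := exists_simple_mul_eq hX hT hZ hy hs hx' he
    exact ⟨x', hx', z', hz', h'⟩

/-- A double coset representative stabilized by two generators is trivial. -/
lemma eq_one_of_nontrivial (hnc : ∀ i j : B, i ≠ j →
      cs.simple i * cs.simple j ≠ cs.simple j * cs.simple i) {T : Set B} {w : W}
    (hT : cs.LeftMinimal T w⁻¹)
    (hZ : {t | t ∈ T ∧ ∃ x ∈ X, cs.simple x * w = w * cs.simple t}.Nontrivial) : w = 1 := by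
  obtain ⟨s, ⟨hs, s', -, hs'⟩, t, ⟨ht, t', -, ht'⟩, hst⟩ := hZ
  have key : ∀ s ∈ T, ¬ cs.IsRightDescent w s := fun s hs => by
    have := hT.length_mul_right (simple_mem_parabolic hs)
    rw [IsRightDescent]
    omega
  exact eq_one_of_mul_simple_eq hnc hst (key s hs) (key t ht) hs' ht'

variable (cs X) in
/-- The image of a generator in the wreath product. -/
noncomputable def labelGen (s : B) : (W → G) ⋊[funAct G (rightPerm W)] W :=
  ⟨fun u => cs.label X f u s, cs.simple s⟩

lemma labelGen_left_apply (u p : W) (s : B) :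
    (cs.labelGen X f s).left ((rightPerm W p)⁻¹ u) = cs.label X f (u * p) s := by
  rw [rightPerm_inv_apply]
  rfl

lemma altProd_labelGen (hnc : ∀ i j : B, i ≠ j →
      cs.simple i * cs.simple j ≠ cs.simple j * cs.simple i)
    (hf : ∀ s ∈ X, ∀ t ∈ X, s ≠ t → altProd (f s) (f t) (C s t) = altProd (f t) (f s) (C s t))
    {s t : B} (hst : s ≠ t) :
    altProd (cs.labelGen X f s) (cs.labelGen X f t) (C s t) =
      altProd (cs.labelGen X f t) (cs.labelGen X f s) (C s t) := by
  refine SemidirectProduct.ext (funext fun u => ?_) ?_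
  swap
  · rw [altProd_right, altProd_right]
    exact (altProd_comm_iff (cs.simple_mul_simple_self s) (cs.simple_mul_simple_self t) _).2
      (cs.simple_mul_simple_pow s t)
  have hsK : cs.simple s ∈ cs.parabolic {s, t} := simple_mem_parabolic (by simp)
  have htK : cs.simple t ∈ cs.parabolic {s, t} := simple_mem_parabolic (by simp)
  obtain ⟨v, hv, y, hy, hX, hT⟩ := exists_minimal_doubleCoset (cs := cs) X {s, t} u
  set w := v * u * y with hw
  have hup : ∀ p r, cs.label X f (u * p) r = cs.label X f (w * (y⁻¹ * p)) r := fun p r => by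
    rw [← label_mul_left f hv (u * p), hw]
    congr 1
    group
  rcases Set.subsingleton_or_nontrivial
    {r | r ∈ ({s, t} : Set B) ∧ ∃ x ∈ X, cs.simple x * w = w * cs.simple r} with hZ | hZ
  · classical
    obtain ⟨g, -, hg⟩ := exists_label_eq_pow f hnc hX hT hZ
    have key : ∀ r ∈ ({s, t} : Set B), ∀ p ∈ cs.parabolic {s, t},
        (cs.labelGen X f r).left ((rightPerm W p)⁻¹ u) =
          g ^ (fun ρ => if u * ρ * u⁻¹ ∈ cs.parabolic X then 1 else 0 : W → ℕ)
            (p * (cs.labelGen X f r).right * p⁻¹) := by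
      intro r hr p hp
      rw [labelGen_left_apply, hup, hg _ (mul_mem (inv_mem hy) hp) r hr]
      refine congrArg (g ^ ·) (if_congr ?_ rfl rfl)
      have e : w * (y⁻¹ * p) * cs.simple r * (w * (y⁻¹ * p))⁻¹ =
          v * (u * (p * cs.simple r * p⁻¹) * u⁻¹) * v⁻¹ := by
        rw [hw]; group
      rw [e]
      exact (Subgroup.mul_mem_cancel_right _ (inv_mem hv)).trans
        (Subgroup.mul_mem_cancel_left _ hv)
    exact altProd_left_comm (g := g)
      (χ := fun ρ => if u * ρ * u⁻¹ ∈ cs.parabolic X then 1 else 0)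
      (cs.simple_mul_simple_self s) (cs.simple_mul_simple_self t)
      (cs.simple_mul_simple_pow s t) hsK htK (key s (by simp)) (key t (by simp))
  · have hw1 := eq_one_of_nontrivial hnc hT hZ
    have hmem : ∀ r, (r ∈ ({s, t} : Set B) ∧ ∃ x ∈ X, cs.simple x * w = w * cs.simple r) →
        r ∈ X := by
      rintro r ⟨-, x, hx, he⟩
      rw [hw1, mul_one, one_mul] at he
      rwa [← simple_inj hnc he]
    obtain ⟨a, ha, b, hb, hab⟩ := hZ
    have hXst : s ∈ X ∧ t ∈ X := by
      have h1 := hmem a ha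
      have h2 := hmem b hb
      rcases ha.1 with rfl | rfl <;> rcases hb.1 with rfl | rfl
      · exact absurd rfl hab
      · exact ⟨h1, h2⟩
      · exact ⟨h2, h1⟩
      · exact absurd rfl hab
    have hsub : cs.parabolic {s, t} ≤ cs.parabolic X :=
      Subgroup.closure_mono (Set.image_mono (by rintro r (rfl | rfl); exacts [hXst.1, hXst.2]))
    have key : ∀ r ∈ X, ∀ p ∈ cs.parabolic {s, t},
        (cs.labelGen X f r).left ((rightPerm W p)⁻¹ u) = f r := by
      intro r hr p hp
      rw [labelGen_left_apply, hup, hw1, one_mul]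
      exact label_of_mem f hnc (hsub (mul_mem (inv_mem hy) hp)) hr
    rw [altProd_left_eq_altProd hsK htK (key s hXst.1) (key t hXst.2),
      altProd_left_eq_altProd htK hsK (key t hXst.2) (key s hXst.1), hf s hXst.1 t hXst.2 hst]

end Label

end CoxeterSystem

/-! ### Homomorphisms from Artin groups -/

section Artin

variable {S H : Type*} [Group H] {M : S → S → ℕ∞}

/-- The homomorphism from an Artin group determined by elements satisfying the braid relations. -/
def artinLift (F : S → H) (hF : ∀ s t, s ≠ t →
      altProd (F s) (F t) (M s t).toNat = altProd (F t) (F s) (M s t).toNat) :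
    ArtinGroup M →* H :=
  PresentedGroup.toGroup (f := F) <| by
    rintro r ⟨s, t, hst, k, hk, rfl⟩
    have := hF s t hst
    rw [hk, ENat.toNat_natCast] at this
    rw [map_mul, map_inv, lift_braidWord, lift_braidWord, this, mul_inv_cancel]

@[simp]
lemma artinLift_of (F : S → H) (hF : ∀ s t, s ≠ t →
      altProd (F s) (F t) (M s t).toNat = altProd (F t) (F s) (M s t).toNat) (s : S) :
    artinLift F hF (PresentedGroup.of s) = F s :=
  PresentedGroup.toGroup.of _

lemma altProd_of (M : S → S → ℕ∞) {s t : S} (hst : s ≠ t) :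
    altProd (PresentedGroup.of s : ArtinGroup M) (PresentedGroup.of t) (M s t).toNat =
      altProd (PresentedGroup.of t) (PresentedGroup.of s) (M s t).toNat := by
  rcases eq_or_ne (M s t) ⊤ with h | h
  · simp [h]
  · have h1 : braidWord (M s t).toNat s t * (braidWord (M s t).toNat t s)⁻¹ ∈ artinRels M :=
      ⟨s, t, hst, _, (ENat.natCast_toNat h).symm, rfl⟩
    have h2 := PresentedGroup.one_of_mem h1
    have h3 : ∀ g : FreeGroup S, PresentedGroup.mk (artinRels M) g =
        FreeGroup.lift (fun s => (PresentedGroup.of s : ArtinGroup M)) g := fun g => by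
      refine DFunLike.congr_fun (f := PresentedGroup.mk (artinRels M)) ?_ g
      ext s
      simp [PresentedGroup.of]
    rwa [h3, map_mul, map_inv, lift_braidWord, lift_braidWord, mul_inv_eq_one] at h2

lemma of_mem_standardParabolic {X : Set S} {s : S} (hs : s ∈ X) :
    (PresentedGroup.of s : ArtinGroup M) ∈ StandardParabolic M X :=
  Subgroup.subset_closure ⟨s, hs, rfl⟩

lemma standardParabolic_univ_eq_top : StandardParabolic M Set.univ = ⊤ := by
  rw [StandardParabolic, Set.image_univ]
  exact PresentedGroup.closure_range_of _

end Artin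

section CrossedHom

open CoxeterSystem

variable {S W G : Type*} [Group W] [Group G] {M : S → S → ℕ∞} {C : CoxeterMatrix S}
  {cs : CoxeterSystem C W} {X : Set S} {f : S → G}

/-- The projection from an Artin group to its Coxeter group. -/
noncomputable def toCoxeter (cs : CoxeterSystem C W)
    (hM : ∀ s t, s ≠ t → C s t = (M s t).toNat) : ArtinGroup M →* W :=
  artinLift cs.simple fun s t hst => hM s t hst ▸
    (altProd_comm_iff (cs.simple_mul_simple_self s) (cs.simple_mul_simple_self t) _).2
      (cs.simple_mul_simple_pow s t)

/-- The homomorphism to a wreath product given by the labels. -/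
noncomputable def crossedHom (hM : ∀ s t, s ≠ t → C s t = (M s t).toNat)
    (hnc : ∀ i j : S, i ≠ j → cs.simple i * cs.simple j ≠ cs.simple j * cs.simple i)
    (hf : ∀ s ∈ X, ∀ t ∈ X, s ≠ t → altProd (f s) (f t) (C s t) = altProd (f t) (f s) (C s t)) :
    ArtinGroup M →* (W → G) ⋊[funAct G (rightPerm W)] W :=
  artinLift (cs.labelGen X f) fun s t hst => hM s t hst ▸ altProd_labelGen f hnc hf hst

lemma exists_mem_standardParabolic (hM : ∀ s t, s ≠ t → C s t = (M s t).toNat) {v : W}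
    (hv : v ∈ cs.parabolic X) : ∃ γ ∈ StandardParabolic M X, toCoxeter cs hM γ = v := by
  have h : cs.parabolic X = (StandardParabolic M X).map (toCoxeter cs hM) := by
    rw [StandardParabolic, MonoidHom.map_closure, parabolic, ← Set.image_comp]
    congr 1
    refine Set.image_congr fun s _ => ?_
    simp [toCoxeter]
  rw [h] at hv
  exact hv

lemma toCoxeter_mem (hM : ∀ s t, s ≠ t → C s t = (M s t).toNat) {α : ArtinGroup M}
    (hα : α ∈ StandardParabolic M X) : toCoxeter cs hM α ∈ cs.parabolic X := by
  induction hα using Subgroup.closure_induction with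
  | mem x hx =>
    obtain ⟨s, hs, rfl⟩ := hx
    simpa [toCoxeter] using simple_mem_parabolic hs
  | one => simp [one_mem]
  | mul a b _ _ ha hb => rw [map_mul]; exact mul_mem ha hb
  | inv a _ ha => rw [map_inv]; exact inv_mem ha

variable (hM : ∀ s t, s ≠ t → C s t = (M s t).toNat)
    (hnc : ∀ i j : S, i ≠ j → cs.simple i * cs.simple j ≠ cs.simple j * cs.simple i)
    (hf : ∀ s ∈ X, ∀ t ∈ X, s ≠ t → altProd (f s) (f t) (C s t) = altProd (f t) (f s) (C s t))

lemma crossedHom_right (α : ArtinGroup M) :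
    (crossedHom hM hnc hf α).right = toCoxeter cs hM α := by
  have h : SemidirectProduct.rightHom.comp (crossedHom hM hnc hf) = toCoxeter cs hM := by
    ext s
    simp [crossedHom, toCoxeter, labelGen]
  exact DFunLike.congr_fun h α

lemma crossedHom_of_left (s : S) (u : W) :
    (crossedHom hM hnc hf (PresentedGroup.of s)).left u = cs.label X f u s := by
  rw [crossedHom, artinLift_of]
  rfl

lemma crossedHom_mul_left (α β : ArtinGroup M) (u : W) :
    (crossedHom hM hnc hf (α * β)).left u = (crossedHom hM hnc hf α).left u *
      (crossedHom hM hnc hf β).left (u * toCoxeter cs hM α) := by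
  rw [map_mul, SemidirectProduct.mul_left, Pi.mul_apply, funAct_apply, rightPerm_inv_apply,
    crossedHom_right]

lemma crossedHom_one_left (u : W) : (crossedHom hM hnc hf 1).left u = 1 := by
  rw [map_one]
  rfl

lemma crossedHom_inv_left (α : ArtinGroup M) (u : W) :
    (crossedHom hM hnc hf α⁻¹).left u =
      ((crossedHom hM hnc hf α).left (u * (toCoxeter cs hM α)⁻¹))⁻¹ := by
  rw [eq_inv_iff_mul_eq_one, ← map_inv, ← crossedHom_mul_left, inv_mul_cancel,
    crossedHom_one_left]

lemma crossedHom_left_mem_aux (Y : Set S) (K : Subgroup G) {w : W}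
    (hK : ∀ y ∈ cs.parabolic Y, ∀ s ∈ Y, cs.label X f (w * y) s ∈ K) {α : ArtinGroup M}
    (hα : α ∈ StandardParabolic M Y) :
    ∀ y ∈ cs.parabolic Y, (crossedHom hM hnc hf α).left (w * y) ∈ K := by
  induction hα using Subgroup.closure_induction with
  | mem x hx =>
    obtain ⟨s, hs, rfl⟩ := hx
    intro y hy
    rw [crossedHom_of_left]
    exact hK y hy s hs
  | one => intro y hy; rw [crossedHom_one_left]; exact one_mem K
  | mul a b ha' _ ha hb =>
    intro y hy
    rw [crossedHom_mul_left, mul_assoc]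
    exact mul_mem (ha y hy) (hb _ (mul_mem hy (toCoxeter_mem hM ha')))
  | inv a ha' ha =>
    intro y hy
    rw [crossedHom_inv_left, mul_assoc]
    exact inv_mem (ha _ (mul_mem hy (inv_mem (toCoxeter_mem hM ha'))))

/-- If all the labels in the `W_Y`-orbit of `w` lie in `K`, so do the values of the crossed
homomorphism on `A_Y`. -/
lemma crossedHom_left_mem_of_orbit (Y : Set S) (K : Subgroup G) {w : W}
    (hK : ∀ y ∈ cs.parabolic Y, ∀ s ∈ Y, cs.label X f (w * y) s ∈ K) {α : ArtinGroup M}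
    (hα : α ∈ StandardParabolic M Y) : (crossedHom hM hnc hf α).left w ∈ K := by
  simpa using crossedHom_left_mem_aux hM hnc hf Y K hK hα 1 (one_mem _)

lemma crossedHom_left_mem (K : Subgroup G) (hK : ∀ x ∈ X, f x ∈ K) (α : ArtinGroup M) (u : W) :
    (crossedHom hM hnc hf α).left u ∈ K :=
  crossedHom_left_mem_of_orbit hM hnc hf Set.univ K (fun _ _ _ _ => label_mem f K hK _ _)
    (by rw [standardParabolic_univ_eq_top]; trivial)

lemma crossedHom_mul_left_of_mem {v : W} (hv : v ∈ cs.parabolic X) (α : ArtinGroup M) :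
    ∀ u, (crossedHom hM hnc hf α).left (v * u) = (crossedHom hM hnc hf α).left u := by
  have hα : α ∈ StandardParabolic M Set.univ := by
    rw [standardParabolic_univ_eq_top]; trivial
  induction hα using Subgroup.closure_induction with
  | mem x hx =>
    obtain ⟨s, hs, rfl⟩ := hx
    intro u
    rw [crossedHom_of_left, crossedHom_of_left, label_mul_left f hv]
  | one => intro u; rw [crossedHom_one_left, crossedHom_one_left]
  | mul a b _ _ ha hb =>
    intro u
    rw [crossedHom_mul_left, crossedHom_mul_left, mul_assoc, ha, hb]
  | inv a _ ha =>
    intro u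
    rw [crossedHom_inv_left, crossedHom_inv_left, mul_assoc, ha]

/-- On `A_X` the crossed homomorphism restricts to the identity. -/
lemma crossedHom_left_eq_self
    (hf : ∀ s ∈ X, ∀ t ∈ X, s ≠ t →
      altProd (PresentedGroup.of s : ArtinGroup M) (PresentedGroup.of t) (C s t) =
        altProd (PresentedGroup.of t) (PresentedGroup.of s) (C s t))
    {α : ArtinGroup M} (hα : α ∈ StandardParabolic M X) :
    ∀ v ∈ cs.parabolic X, (crossedHom hM hnc hf α).left v = α := by
  induction hα using Subgroup.closure_induction with
  | mem x hx =>
    obtain ⟨s, hs, rfl⟩ := hx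
    intro v hv
    rw [crossedHom_of_left, label_of_mem _ hnc hv hs]
  | one => intro v hv; rw [crossedHom_one_left]
  | mul a b ha' _ ha hb =>
    intro v hv
    rw [crossedHom_mul_left, ha v hv, hb _ (mul_mem hv (toCoxeter_mem hM ha'))]
  | inv a ha' ha =>
    intro v hv
    rw [crossedHom_inv_left, ha _ (mul_mem hv (inv_mem (toCoxeter_mem hM ha')))]

end CrossedHom

/-! ### Conjugacy in standard parabolic subgroups of large-type Artin groups -/

section Conjugacy

open CoxeterSystem

variable {S : Type*} {M : S → S → ℕ∞} {X : Set S}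

lemma oddConnected_iff_of_odd (hsymm : ∀ s t : S, M s t = M t s) {s t : S} (hs : s ∈ X)
    (ht : t ∈ X) (h : Odd (M s t).toNat) (z : S) :
    OddConnected M X z s ↔ OddConnected M X z t := by
  have hne : M s t ≠ ⊤ := fun h' => by simp [h'] at h
  have hk : M s t = ((M s t).toNat : ℕ∞) := (ENat.natCast_toNat hne).symm
  exact ⟨fun h' => h'.tail ⟨hs, ht, _, hk, h⟩,
    fun h' => h'.tail ⟨ht, hs, _, (hsymm t s).trans hk, h⟩⟩

lemma exists_conj_of_oddConnected {a b : S} (h : OddConnected M X a b) :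
    ∃ β ∈ StandardParabolic M X,
      (PresentedGroup.of a : ArtinGroup M) = β⁻¹ * PresentedGroup.of b * β := by
  induction h with
  | refl => exact ⟨1, one_mem _, by simp⟩
  | @tail b c _ hbc ih =>
    obtain ⟨β, hβ, he⟩ := ih
    obtain ⟨hb, hc, k, hk, hodd⟩ := hbc
    rcases eq_or_ne b c with rfl | hne
    · exact ⟨β, hβ, he⟩
    have h1 := altProd_of M hne
    rw [hk, ENat.toNat_natCast] at h1
    have h2 := (altProd_succ' (PresentedGroup.of b : ArtinGroup M) (PresentedGroup.of c) k).symm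
    rw [altProd_succ, if_neg (by rw [Nat.odd_iff.1 hodd]; simp), ← h1] at h2
    refine ⟨(altProd (PresentedGroup.of b) (PresentedGroup.of c) k)⁻¹ * β, mul_mem (inv_mem
      (altProd_mem _ (of_mem_standardParabolic hb) (of_mem_standardParabolic hc) k)) hβ, ?_⟩
    rw [he]
    generalize altProd (PresentedGroup.of b : ArtinGroup M) (PresentedGroup.of c) k = P at h2 ⊢
    rw [eq_mul_inv_of_mul_eq h2]
    group

open Classical in
/-- The homomorphism counting the generators in the odd component of `z`. -/
noncomputable def componentHom (hsymm : ∀ s t : S, M s t = M t s) (z : S) :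
    ArtinGroup M →* Multiplicative ℤ :=
  artinLift (fun s => Multiplicative.ofAdd (if OddConnected M Set.univ z s then 1 else 0))
    fun s t _ => altProd_comm_of_even_or_eq fun h => by
      simp only [oddConnected_iff_of_odd hsymm (Set.mem_univ s) (Set.mem_univ t) h z]

variable {W : Type*} [Group W] {C : CoxeterMatrix S} {cs : CoxeterSystem C W}

/-- Elements of `A_X` that are conjugate in the Artin group are conjugate in `A_X` or are
conjugate in `A_X` to powers of generators. -/
lemma exists_conj_or_exists_conj_zpow (hM : ∀ s t, s ≠ t → C s t = (M s t).toNat)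
    (hnc : ∀ i j : S, i ≠ j → cs.simple i * cs.simple j ≠ cs.simple j * cs.simple i)
    {a b α : ArtinGroup M} (ha : a ∈ StandardParabolic M X) (hb : b ∈ StandardParabolic M X)
    (h : a = α⁻¹ * b * α) :
    (∃ β ∈ StandardParabolic M X, a = β⁻¹ * b * β) ∨
      ∃ β ∈ StandardParabolic M X, ∃ x ∈ X, ∃ k : ℤ,
        b = β⁻¹ * PresentedGroup.of x ^ k * β := by
  have hf : ∀ s ∈ X, ∀ t ∈ X, s ≠ t →
      altProd (PresentedGroup.of s : ArtinGroup M) (PresentedGroup.of t) (C s t) =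
        altProd (PresentedGroup.of t) (PresentedGroup.of s) (C s t) := fun s _ t _ hst => by
    rw [hM s t hst, altProd_of M hst]
  obtain ⟨v, hv, y, hy, hX, hT⟩ := exists_minimal_doubleCoset (cs := cs) X X (toCoxeter cs hM α)
  obtain ⟨γ, hγ, rfl⟩ := exists_mem_standardParabolic hM hy
  set w := v * toCoxeter cs hM α * toCoxeter cs hM γ with hw
  set δ := (crossedHom hM hnc hf (α * γ)).left 1 with hδ
  have hδX : δ ∈ StandardParabolic M X :=
    crossedHom_left_mem hM hnc hf _ (fun x hx => of_mem_standardParabolic hx) _ _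
  have ha' : γ⁻¹ * a * γ ∈ StandardParabolic M X := mul_mem (mul_mem (inv_mem hγ) ha) hγ
  have hval : b * δ = δ * (crossedHom hM hnc hf (γ⁻¹ * a * γ)).left w := by
    have e : b * (α * γ) = (α * γ) * (γ⁻¹ * a * γ) := by rw [h]; group
    have e1 := congrArg (fun g => (crossedHom hM hnc hf g).left 1) e
    rw [crossedHom_mul_left, crossedHom_mul_left _ _ _ (α * γ),
      crossedHom_left_eq_self hM hnc hf hb 1 (one_mem _), one_mul, one_mul,
      ← mul_one (toCoxeter cs hM b), crossedHom_mul_left_of_mem hM hnc hf (toCoxeter_mem hM hb),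
      ← crossedHom_mul_left_of_mem hM hnc hf hv (γ⁻¹ * a * γ), map_mul (toCoxeter cs hM),
      ← mul_assoc v] at e1
    exact e1
  rcases Set.subsingleton_or_nontrivial
    {r | r ∈ X ∧ ∃ x ∈ X, cs.simple x * w = w * cs.simple r} with hZ | hZ
  · classical
    obtain ⟨g, hg, hlab⟩ := exists_label_eq_pow
      (fun s => (PresentedGroup.of s : ArtinGroup M)) hnc hX hT hZ
    obtain ⟨k, hk⟩ := crossedHom_left_mem_of_orbit hM hnc hf X (Subgroup.zpowers g) (w := w)
      (fun y hy s hs => by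
        rw [hlab y hy s hs]
        exact Subgroup.npow_mem_zpowers g _) ha'
    simp only at hk
    rw [← hk] at hval
    have hb' : b = δ * g ^ k * δ⁻¹ := eq_mul_inv_of_mul_eq hval
    rcases hg with rfl | ⟨x, hx, rfl⟩
    · left
      have hb1 : b = 1 := by rw [hb']; simp
      exact ⟨1, one_mem _, by rw [h, hb1]; simp⟩
    · right
      exact ⟨δ⁻¹, inv_mem hδX, x, hx, k, by rw [hb', inv_inv]⟩
  · left
    rw [eq_one_of_nontrivial hnc hT hZ, crossedHom_left_eq_self hM hnc hf ha' 1 (one_mem _)]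
      at hval
    refine ⟨δ * γ⁻¹, mul_mem hδX (inv_mem hγ), ?_⟩
    have e : a = γ * (δ⁻¹ * (δ * (γ⁻¹ * a * γ))) * γ⁻¹ := by group
    rw [e, ← hval]
    group

/-- Generators of `X` that are conjugate in `A_X` lie in the same odd component of `Γ_X`. -/
lemma oddConnected_of_conj (hsymm : ∀ s t : S, M s t = M t s)
    (hM : ∀ s t, s ≠ t → C s t = (M s t).toNat)
    (hnc : ∀ i j : S, i ≠ j → cs.simple i * cs.simple j ≠ cs.simple j * cs.simple i)
    {a b : S} (ha : a ∈ X) (hb : b ∈ X) {β : ArtinGroup M} (hβ : β ∈ StandardParabolic M X)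
    (h : (PresentedGroup.of a : ArtinGroup M) = β⁻¹ * PresentedGroup.of b * β) :
    OddConnected M X a b := by
  classical
  let f : S → Multiplicative ℤ :=
    fun s => Multiplicative.ofAdd (if OddConnected M X a s then 1 else 0)
  have hf : ∀ s ∈ X, ∀ t ∈ X, s ≠ t →
      altProd (f s) (f t) (C s t) = altProd (f t) (f s) (C s t) := fun s hs t ht hst => by
    refine altProd_comm_of_even_or_eq fun hodd => ?_
    rw [hM s t hst] at hodd
    simp only [f, oddConnected_iff_of_odd hsymm hs ht hodd a]
  have e : PresentedGroup.of b * β = β * PresentedGroup.of a := by rw [h]; group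
  have e1 := congrArg (fun g => (crossedHom hM hnc hf g).left 1) e
  rw [crossedHom_mul_left, crossedHom_mul_left, crossedHom_of_left, crossedHom_of_left, one_mul,
    one_mul, label_of_mem f hnc (one_mem _) hb, label_of_mem f hnc (toCoxeter_mem hM hβ) ha,
    ← mul_one (toCoxeter cs hM _), crossedHom_mul_left_of_mem hM hnc hf
      (toCoxeter_mem hM (of_mem_standardParabolic hb)), mul_comm, mul_right_inj] at e1
  by_contra hab
  have haa : OddConnected M X a a := Relation.ReflTransGen.refl
  simp only [f, if_neg hab, if_pos haa] at e1
  exact zero_ne_one (Multiplicative.ofAdd.injective e1)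

lemma conjugacyStable_of_oddConnected (hsymm : ∀ s t : S, M s t = M t s)
    (hM : ∀ s t, s ≠ t → C s t = (M s t).toNat)
    (hnc : ∀ i j : S, i ≠ j → cs.simple i * cs.simple j ≠ cs.simple j * cs.simple i)
    (h : ∀ a ∈ X, ∀ b ∈ X, OddConnected M Set.univ a b → OddConnected M X a b) :
    ConjugacyStable (StandardParabolic M X) := by
  rintro a b ha hb ⟨α, hα⟩
  rcases exists_conj_or_exists_conj_zpow hM hnc ha hb hα with h1 | ⟨β, hβ, x, hx, k, hk⟩
  · exact h1
  have hα' : b = (α⁻¹)⁻¹ * a * α⁻¹ := by rw [hα]; group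
  rcases exists_conj_or_exists_conj_zpow hM hnc hb ha hα' with
    ⟨γ, hγ, h1⟩ | ⟨γ, hγ, y, hy, l, hl⟩
  · exact ⟨γ⁻¹, inv_mem hγ, by rw [h1]; group⟩
  have hxx : OddConnected M Set.univ x x := Relation.ReflTransGen.refl
  have hab : componentHom hsymm x a = componentHom hsymm x b := by
    rw [hα, map_mul, map_mul, map_inv, mul_comm, mul_inv_cancel_left]
  rw [hk, hl] at hab
  simp only [map_mul, map_inv, map_zpow, componentHom, artinLift_of, if_pos hxx] at hab
  by_cases hxy : OddConnected M Set.univ x y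
  · have hkl : l = k := by
      simpa [if_pos hxy, ← ofAdd_zsmul] using hab
    subst hkl
    obtain ⟨β₀, hβ₀, he⟩ := exists_conj_of_oddConnected (h x hx y hy hxy)
    refine ⟨(β₀ * β)⁻¹ * γ, mul_mem (inv_mem (mul_mem hβ₀ hβ)) hγ, ?_⟩
    have e : (PresentedGroup.of x : ArtinGroup M) ^ l =
        β₀⁻¹ * PresentedGroup.of y ^ l * β₀ := by
      have := conj_zpow (i := l) (a := β₀⁻¹) (b := (PresentedGroup.of y : ArtinGroup M))
      rwa [inv_inv, ← he] at this
    rw [hl, hk, e]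
    group
  · have hk0 : k = 0 := by
      simp only [if_neg hxy, ofAdd_zero, one_zpow, mul_one, inv_mul_cancel, ← ofAdd_zsmul,
        smul_eq_mul, inv_mul_cancel_comm] at hab
      exact ofAdd_eq_one.1 hab.symm
    have hb1 : b = 1 := by rw [hk, hk0]; simp
    exact ⟨1, one_mem _, by rw [hα, hb1]; simp⟩

open Classical in
/-- The Coxeter matrix underlying a large-type matrix. -/
noncomputable def largeCoxeterMatrix (M : S → S → ℕ∞) (hsymm : ∀ s t : S, M s t = M t s)
    (hlarge : ∀ s t : S, s ≠ t → 3 ≤ M s t) : CoxeterMatrix S where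
  M := Matrix.of fun s t => if s = t then 1 else (M s t).toNat
  isSymm := by
    ext s t
    simp [hsymm s t, eq_comm]
  diagonal s := by simp
  off_diagonal s t hst h := by
    have h1 := hlarge s t hst
    rw [Matrix.of_apply, if_neg hst] at h
    rw [(ENat.toNat_eq_iff one_ne_zero).1 h] at h1
    exact absurd h1 (by norm_num)

end Conjugacy

/-- A standard parabolic subgroup `A_X` of a large-type Artin group is not conjugacy
stable iff some vertices `a, b` of `Γ_X` are connected by an odd-labelled path in
`Γ_S` but not in `Γ_X`. -/
theorem conjugacy_stability_characterisation {S : Type*} [Finite S] (M : S → S → ℕ∞)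
    (hsymm : ∀ s t : S, M s t = M t s)
    (hlarge : ∀ s t : S, s ≠ t → 3 ≤ M s t)
    (X : Set S) :
    ¬ ConjugacyStable (StandardParabolic M X) ↔
      ∃ a ∈ X, ∃ b ∈ X, OddConnected M Set.univ a b ∧ ¬ OddConnected M X a b := by
  have hM : ∀ s t, s ≠ t → largeCoxeterMatrix M hsymm hlarge s t = (M s t).toNat :=
    fun s t hst => if_neg hst
  have hnc : ∀ i j : S, i ≠ j → (largeCoxeterMatrix M hsymm hlarge).toCoxeterSystem.simple i *
      (largeCoxeterMatrix M hsymm hlarge).toCoxeterSystem.simple j ≠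
      (largeCoxeterMatrix M hsymm hlarge).toCoxeterSystem.simple j *
      (largeCoxeterMatrix M hsymm hlarge).toCoxeterSystem.simple i := by
    refine fun i j hij => CoxeterSystem.simple_mul_simple_ne _ hij fun h => ?_
    rw [hM i j hij] at h
    have h1 := hlarge i j hij
    rw [(ENat.toNat_eq_iff two_ne_zero).1 h] at h1
    exact absurd h1 (by norm_num)
  constructor
  · contrapose!
    exact fun h => conjugacyStable_of_oddConnected hsymm hM hnc h
  · rintro ⟨a, ha, b, hb, h, hn⟩ hs
    obtain ⟨α, -, hα⟩ := exists_conj_of_oddConnected h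
    obtain ⟨β, hβ, he⟩ := hs _ _ (of_mem_standardParabolic ha) (of_mem_standardParabolic hb)
      ⟨α, hα⟩
    exact hn (oddConnected_of_conj hsymm hM hnc ha hb hβ he)
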